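/- arXiv:2602.03605 — 2 statements merged into one kernel-verified Lean document; each statement's English description precedes it below -/
import Mathlib

section
/- Let G = (V,E) be a connected graph on V = {1,…,n} with n ≥ 2, let 0 ≤ s < 1, and let H_s = −∑_{(i,j)∈E} |φ_s⟩⟨φ_s|_{i,j} where |φ_s⟩ = |00⟩ + s|11⟩ and the subscript denotes the two-qubit operator applied to qubits i,j (tensored with identity elsewhere). Then the smallest eigenvalue of H_s is non-degenerate (its eigenspace is one-dimensional), and the corresponding ground state can be chosen so that its amplitude on every bit string of odd Hamming weight is zero and its amplitude on every bit string of even Hamming weight is a nonnegative real number. -/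
open Complex Finset

/-- The projector |φ_s⟩⟨φ_s| (|φ_s⟩ = |00⟩ + s|11⟩, unnormalized) applied to
qubits `i`, `j` of an n-qubit system, tensored with identity elsewhere. -/
def projPhi {n : ℕ} (s : ℝ) (i j : Fin n) :
    Matrix (Fin n → Bool) (Fin n → Bool) ℂ :=
  Matrix.of fun x y =>
    (if ¬ x i ∧ ¬ x j then 1 else if x i ∧ x j then (s : ℂ) else 0) *
    (if ¬ y i ∧ ¬ y j then 1 else if y i ∧ y j then (s : ℂ) else 0) *
    ∏ a ∈ (Finset.univ.erase i).erase j, (if x a = y a then (1 : ℂ) else 0)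

open scoped ComplexOrder Matrix

theorem Matrix.IsHermitian.exists_top_eigenvector {ι : Type*} [Fintype ι] [DecidableEq ι]
    [Nonempty ι] {A : Matrix ι ι ℂ} (hA : A.IsHermitian) :
    ∃ (t : ℝ) (v : ι → ℂ), v ≠ 0 ∧ A.mulVec v = (t : ℂ) • v ∧
      ((t : ℂ) • (1 : Matrix ι ι ℂ) - A).PosSemidef := by
  obtain ⟨i, hi⟩ := Finite.exists_max hA.eigenvalues
  refine ⟨hA.eigenvalues i, hA.eigenvectorBasis i, ?_, hA.mulVec_eigenvectorBasis i, ?_⟩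
  · intro h
    apply hA.eigenvectorBasis.toBasis.ne_zero i
    ext x
    simpa using congrFun h x
  · rw [Matrix.posSemidef_iff_isHermitian_and_spectrum_nonneg]
    refine ⟨?_, ?_⟩
    · refine Matrix.IsHermitian.sub ?_ hA
      simp [Matrix.IsHermitian, Matrix.conjTranspose_smul]
    · intro z hz
      rw [← Algebra.algebraMap_eq_smul_one, ← spectrum.singleton_sub_eq,
        hA.spectrum_eq_image_range] at hz
      obtain ⟨_, rfl, _, ⟨_, ⟨j, rfl⟩, rfl⟩, rfl⟩ := hz
      have := hi j
      simpa using this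

/-- For an entrywise nonnegative matrix, the entrywise modulus of a top eigenvector is again a
top eigenvector. -/
theorem Matrix.mulVec_norm_of_mulVec_eq {ι : Type*} [Fintype ι] [DecidableEq ι]
    {M : Matrix ι ι ℂ} (hM : ∀ x y, 0 ≤ M x y) {t : ℝ}
    (ht : ((t : ℂ) • (1 : Matrix ι ι ℂ) - M).PosSemidef) {v : ι → ℂ}
    (hv : M.mulVec v = (t : ℂ) • v) :
    M.mulVec (fun x => (‖v x‖ : ℂ)) = (t : ℂ) • fun x => (‖v x‖ : ℂ) := by
  set w : ι → ℂ := fun x => (‖v x‖ : ℂ) with hw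
  have hMn : ∀ x y, M x y = (‖M x y‖ : ℂ) := fun x y => by
    rw [Complex.eq_coe_norm_of_nonneg (hM x y)]; simp
  have hpos := ht.dotProduct_mulVec_nonneg w
  have key : star w ⬝ᵥ (((t : ℂ) • (1 : Matrix ι ι ℂ) - M) *ᵥ w) =
      ((t * ∑ x, ‖v x‖ ^ 2 - ∑ x, ∑ y, ‖v x‖ * (‖M x y‖ * ‖v y‖) : ℝ) : ℂ) := by
    simp only [Matrix.sub_mulVec, Matrix.smul_mulVec, Matrix.one_mulVec, dotProduct_sub,
      dotProduct_smul]
    push_cast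
    congr 1
    · simp [dotProduct, hw, sq]
    · simp only [dotProduct, Matrix.mulVec, Finset.mul_sum]
      refine Finset.sum_congr rfl fun x _ => Finset.sum_congr rfl fun y _ => ?_
      rw [← hMn]
      simp [hw]
  have hle : t * ∑ x, ‖v x‖ ^ 2 ≤ ∑ x, ∑ y, ‖v x‖ * (‖M x y‖ * ‖v y‖) := by
    have h1 : ((t * ∑ x, ‖v x‖ ^ 2 : ℝ) : ℂ) = ∑ x, ∑ y, star (v x) * (M x y * v y) := by
      have h2 : star v ⬝ᵥ (M *ᵥ v) = star v ⬝ᵥ ((t : ℂ) • v) := by rw [hv]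
      simp only [dotProduct, Matrix.mulVec, Finset.mul_sum, Pi.star_apply] at h2
      refine Eq.trans ?_ h2.symm
      push_cast
      rw [Finset.mul_sum]
      refine Finset.sum_congr rfl fun x _ => ?_
      simp only [Pi.smul_apply, smul_eq_mul, Complex.star_def]
      rw [← Complex.conj_mul']
      ring
    have h3 : t * ∑ x, ‖v x‖ ^ 2 ≤ ‖((t * ∑ x, ‖v x‖ ^ 2 : ℝ) : ℂ)‖ := by
      rw [Complex.norm_real]; exact le_abs_self _
    refine h3.trans ?_
    rw [h1]
    refine (norm_sum_le _ _).trans (Finset.sum_le_sum fun x _ => (norm_sum_le _ _).trans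
      (Finset.sum_le_sum fun y _ => ?_))
    simp
  have hzero : star w ⬝ᵥ (((t : ℂ) • (1 : Matrix ι ι ℂ) - M) *ᵥ w) = 0 := by
    refine le_antisymm ?_ hpos
    rw [key]
    exact_mod_cast sub_nonpos.mpr hle
  rw [ht.dotProduct_mulVec_zero_iff, Matrix.sub_mulVec, Matrix.smul_mulVec,
    Matrix.one_mulVec, sub_eq_zero] at hzero
  exact hzero.symm

/-- Zeros of a nonnegative eigenvector propagate along nonzero entries. -/
theorem Matrix.eq_zero_of_mulVec_eq {ι : Type*} [Fintype ι]
    {M : Matrix ι ι ℂ} (hM : ∀ x y, 0 ≤ M x y) {t : ℂ} {w : ι → ℂ}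
    (hw : ∀ x, 0 ≤ w x) (hMw : M.mulVec w = t • w) {x y : ι} (hx : w x = 0)
    (hxy : M x y ≠ 0) : w y = 0 := by
  have h := congrFun hMw x
  simp only [Matrix.mulVec, dotProduct, Pi.smul_apply, hx, smul_zero] at h
  rw [Finset.sum_eq_zero_iff_of_nonneg fun z _ => mul_nonneg (hM x z) (hw z)] at h
  exact (mul_eq_zero.mp (h y (Finset.mem_univ y))).resolve_left hxy

theorem Matrix.le_re_of_hasEigenvalue_neg {ι : Type*} [Fintype ι] [DecidableEq ι]
    {A : Matrix ι ι ℂ} {t : ℝ} (ht : ((t : ℂ) • (1 : Matrix ι ι ℂ) - A).PosSemidef) {z : ℂ}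
    (hz : Module.End.HasEigenvalue (Matrix.toLin' (-A)) z) : -t ≤ z.re := by
  obtain ⟨v, hv⟩ := hz.exists_hasEigenvector
  have hv' : A *ᵥ v = -z • v := by
    have h := hv.apply_eq_smul
    rw [Matrix.toLin'_apply, Matrix.neg_mulVec] at h
    rw [neg_smul, ← h, neg_neg]
  have h := ht.dotProduct_mulVec_nonneg v
  rw [Matrix.sub_mulVec, Matrix.smul_mulVec, Matrix.one_mulVec, hv', ← sub_smul,
    dotProduct_smul, smul_eq_mul] at h
  have h0 : 0 < star v ⬝ᵥ v := Matrix.dotProduct_star_self_pos_iff.mpr hv.2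
  have h1 : (0 : ℂ) ≤ (t : ℂ) - -z := by
    refine le_of_mul_le_mul_right ?_ h0
    rwa [zero_mul]
  have h2 := (Complex.le_def.mp h1).1
  simp at h2
  linarith

/-- The sum of a function against the indicator of agreement with `x` away from `i` and `j`. -/
theorem sum_mul_prod_agree {n : ℕ} {i j : Fin n} (hij : i ≠ j) (x : Fin n → Bool)
    (g : (Fin n → Bool) → ℂ) :
    ∑ y, g y * ∏ a ∈ (Finset.univ.erase i).erase j, (if x a = y a then (1 : ℂ) else 0) =
      ∑ b : Bool, ∑ c : Bool, g (Function.update (Function.update x i b) j c) := by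
  simp only [Finset.prod_boole, mul_ite, mul_one, mul_zero]
  rw [← Finset.sum_filter, ← Fintype.sum_prod_type']
  refine Finset.sum_nbij' (fun y => (y i, y j))
    (fun p => Function.update (Function.update x i p.1) j p.2) (by simp) ?_ ?_ ?_ ?_
  · rintro p -
    simp only [Finset.mem_filter, Finset.mem_univ, true_and, Finset.mem_erase, and_true]
    rintro a ⟨haj, hai⟩
    simp [haj, hai]
  · intro y hy
    simp only [Finset.mem_filter, Finset.mem_univ, true_and, Finset.mem_erase, and_true] at hy
    funext a
    by_cases haj : a = j
    · subst haj; simp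
    · by_cases hai : a = i
      · subst hai; simp [haj]
      · simp [haj, hai, hy a ⟨haj, hai⟩]
  · rintro ⟨b, c⟩ -
    simp [hij]
  · intro y hy
    simp only [Finset.mem_filter, Finset.mem_univ, true_and, Finset.mem_erase, and_true] at hy
    congr 1
    funext a
    by_cases haj : a = j
    · subst haj; simp
    · by_cases hai : a = i
      · subst hai; simp [haj]
      · simp [haj, hai, hy a ⟨haj, hai⟩]

/-- The rank-one operator `|f⟩⟨f|` of a two-qubit vector `f` with real amplitudes, applied to
qubits `i` and `j`. -/
def pairOp {n : ℕ} (f : Bool → Bool → ℂ) (i j : Fin n) :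
    Matrix (Fin n → Bool) (Fin n → Bool) ℂ :=
  Matrix.of fun x y => f (x i) (x j) * f (y i) (y j) *
    ∏ a ∈ (Finset.univ.erase i).erase j, (if x a = y a then (1 : ℂ) else 0)

/-- The amplitudes of `|00⟩ + s|11⟩`. -/
def phiVec (s : ℝ) (b c : Bool) : ℂ :=
  if ¬ b ∧ ¬ c then 1 else if b ∧ c then (s : ℂ) else 0

/-- The amplitudes of the Hadamard transform of `|00⟩ + s|11⟩`. -/
def phiHat (s : ℝ) (b c : Bool) : ℂ := if b = c then ((1 + s : ℝ) : ℂ) else ((1 - s : ℝ) : ℂ)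

theorem projPhi_eq_pairOp {n : ℕ} (s : ℝ) (i j : Fin n) :
    projPhi s i j = pairOp (phiVec s) i j := rfl

theorem pairOp_comm {n : ℕ} (f : Bool → Bool → ℂ) (i j : Fin n) (x y : Fin n → Bool) :
    pairOp f i j x y = pairOp f i j y x := by
  simp only [pairOp, Matrix.of_apply, eq_comm (a := x _), mul_comm (f (x i) (x j))]

theorem pairOp_nonneg {n : ℕ} {f : Bool → Bool → ℂ} (hf : ∀ b c, 0 ≤ f b c) (i j : Fin n)
    (x y : Fin n → Bool) : 0 ≤ pairOp f i j x y := by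
  refine mul_nonneg (mul_nonneg (hf _ _) (hf _ _)) (Finset.prod_nonneg fun a _ => ?_)
  split_ifs <;> simp

/-- The single-qubit Hadamard sign. -/
def hadSign (b c : Bool) : ℂ := if b ∧ c then -1 else 1

/-- The unnormalized Hadamard transform on `n` qubits. -/
def hadamard (n : ℕ) : Matrix (Fin n → Bool) (Fin n → Bool) ℂ :=
  Matrix.of fun k x => ∏ a, hadSign (k a) (x a)

theorem hadamard_comm {n : ℕ} (k x : Fin n → Bool) : hadamard n k x = hadamard n x k := by
  simp only [hadamard, Matrix.of_apply, hadSign, and_comm]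

theorem hadamard_isHermitian (n : ℕ) : (hadamard n)ᴴ = hadamard n := by
  ext k x
  rw [Matrix.conjTranspose_apply, hadamard_comm]
  simp only [hadamard, Matrix.of_apply, star_prod]
  refine Finset.prod_congr rfl fun a _ => ?_
  simp only [hadSign]
  split_ifs <;> simp

theorem hadamard_mul_self (n : ℕ) : hadamard n * hadamard n = (2 ^ n : ℂ) • 1 := by
  ext k l
  simp only [Matrix.mul_apply, hadamard, Matrix.of_apply, ← Finset.prod_mul_distrib]
  rw [← Fintype.prod_sum (fun a b => hadSign (k a) b * hadSign b (l a))]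
  have h : ∀ a, ∑ b, hadSign (k a) b * hadSign b (l a) = if k a = l a then 2 else 0 := by
    intro a
    cases k a <;> cases l a <;> norm_num [hadSign]
  simp only [h, Matrix.smul_apply, Matrix.one_apply, smul_eq_mul, mul_ite, mul_one, mul_zero]
  split_ifs with hkl
  · simp [hkl]
  · obtain ⟨a, ha⟩ := Function.ne_iff.mp hkl
    exact Finset.prod_eq_zero (Finset.mem_univ a) (if_neg ha)

theorem hadamard_update_right {n : ℕ} {i j : Fin n} (hij : i ≠ j) (k x : Fin n → Bool)
    (b c : Bool) : hadamard n k (Function.update (Function.update x i b) j c) =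
      hadSign (k i) b * hadSign (k j) c *
        ∏ a ∈ (Finset.univ.erase i).erase j, hadSign (k a) (x a) := by
  have hj : j ∈ Finset.univ.erase i := Finset.mem_erase.mpr ⟨hij.symm, Finset.mem_univ j⟩
  simp only [hadamard, Matrix.of_apply]
  rw [← Finset.mul_prod_erase _ _ (Finset.mem_univ i), ← Finset.mul_prod_erase _ _ hj, ← mul_assoc]
  congr 1
  · simp [hij]
  · refine Finset.prod_congr rfl fun a ha => ?_
    simp only [Finset.mem_erase, Finset.mem_univ, and_true] at ha
    simp [ha.1, ha.2]

/-- The Hadamard transform intertwines `|φ_s⟩⟨φ_s|` with an operator with positive blocks. -/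
theorem hadamard_mul_pairOp {n : ℕ} (s : ℝ) {i j : Fin n} (hij : i ≠ j) :
    (4 : ℂ) • (hadamard n * pairOp (phiVec s) i j) = pairOp (phiHat s) i j * hadamard n := by
  ext k x
  have hL : (hadamard n * pairOp (phiVec s) i j) k x = phiVec s (x i) (x j) *
      ∑ b : Bool, ∑ c : Bool, hadamard n k (Function.update (Function.update x i b) j c) *
        phiVec s b c := by
    have := sum_mul_prod_agree hij x
      (fun y => phiVec s (x i) (x j) * (hadamard n k y * phiVec s (y i) (y j)))
    simp only [Function.update_self, Function.update_of_ne hij, ← Finset.mul_sum] at this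
    rw [← this, Matrix.mul_apply]
    refine Finset.sum_congr rfl fun y _ => ?_
    rw [pairOp_comm]
    simp only [pairOp, Matrix.of_apply]
    ring
  have hR : (pairOp (phiHat s) i j * hadamard n) k x = phiHat s (k i) (k j) *
      ∑ b : Bool, ∑ c : Bool, hadamard n x (Function.update (Function.update k i b) j c) *
        phiHat s b c := by
    have := sum_mul_prod_agree hij k
      (fun y => phiHat s (k i) (k j) * (hadamard n x y * phiHat s (y i) (y j)))
    simp only [Function.update_self, Function.update_of_ne hij, ← Finset.mul_sum] at this
    rw [← this, Matrix.mul_apply]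
    refine Finset.sum_congr rfl fun y _ => ?_
    rw [hadamard_comm]
    simp only [pairOp, Matrix.of_apply]
    ring
  have hc : ∀ a, hadSign (x a) (k a) = hadSign (k a) (x a) := fun a => by
    simp only [hadSign, and_comm]
  rw [Matrix.smul_apply, hL, hR]
  simp only [hadamard_update_right hij, hc]
  cases x i <;> cases x j <;> cases k i <;> cases k j <;>
    simp [hadSign, phiVec, phiHat] <;> ring

theorem hadSign_true_prod_eq {n : ℕ} {s : ℝ} {i j : Fin n} (hij : i ≠ j) {x y : Fin n → Bool}
    (h : pairOp (phiVec s) i j x y ≠ 0) :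
    ∏ a, hadSign true (x a) = ∏ a, hadSign true (y a) := by
  have hj : j ∈ Finset.univ.erase i := Finset.mem_erase.mpr ⟨hij.symm, Finset.mem_univ j⟩
  simp only [pairOp, Matrix.of_apply, mul_ne_zero_iff, Finset.prod_ne_zero_iff] at h
  obtain ⟨⟨hx, hy⟩, hr⟩ := h
  have hflip : ∀ b c, phiVec s b c ≠ 0 → hadSign true b * hadSign true c = 1 := by
    intro b c
    cases b <;> cases c <;> simp [phiVec, hadSign]
  rw [← Finset.mul_prod_erase _ _ (Finset.mem_univ i), ← Finset.mul_prod_erase _ _ hj, ← mul_assoc,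
    ← Finset.mul_prod_erase _ (fun a => hadSign true (y a)) (Finset.mem_univ i),
    ← Finset.mul_prod_erase _ (fun a => hadSign true (y a)) hj, ← mul_assoc,
    hflip _ _ hx, hflip _ _ hy]
  congr 1
  refine Finset.prod_congr rfl fun a ha => ?_
  have := hr a ha
  simp only [ne_eq, ite_eq_right_iff, one_ne_zero, imp_false, not_not] at this
  rw [this]

theorem hadSign_true_prod {n : ℕ} (x : Fin n → Bool) :
    ∏ a, hadSign true (x a) = (-1) ^ (Finset.univ.filter (fun a => x a)).card := by
  simp [hadSign, Finset.prod_ite]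

/-- The sum of a two-qubit rank-one operator over the ordered pairs of adjacent vertices. -/
def edgeSum {n : ℕ} (G : SimpleGraph (Fin n)) [DecidableRel G.Adj] (f : Bool → Bool → ℂ) :
    Matrix (Fin n → Bool) (Fin n → Bool) ℂ :=
  ∑ i : Fin n, ∑ j : Fin n, if G.Adj i j then pairOp f i j else 0

section edgeSum

variable {n : ℕ} (G : SimpleGraph (Fin n)) [DecidableRel G.Adj]

theorem edgeSum_apply (f : Bool → Bool → ℂ) (x y : Fin n → Bool) :
    edgeSum G f x y = ∑ i, ∑ j, if G.Adj i j then pairOp f i j x y else 0 := by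
  simp only [edgeSum, Matrix.sum_apply]
  refine Finset.sum_congr rfl fun i _ => Finset.sum_congr rfl fun j _ => ?_
  split_ifs <;> rfl

theorem edgeSum_nonneg {f : Bool → Bool → ℂ} (hf : ∀ b c, 0 ≤ f b c) (x y : Fin n → Bool) :
    0 ≤ edgeSum G f x y := by
  rw [edgeSum_apply]
  refine Finset.sum_nonneg fun i _ => Finset.sum_nonneg fun j _ => ?_
  split_ifs
  exacts [pairOp_nonneg hf i j x y, le_rfl]

theorem edgeSum_isHermitian {f : Bool → Bool → ℂ} (hf : ∀ b c, 0 ≤ f b c) :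
    (edgeSum G f).IsHermitian := by
  ext x y
  rw [Matrix.conjTranspose_apply, (IsSelfAdjoint.of_nonneg (edgeSum_nonneg G hf y x)).star_eq]
  simp only [edgeSum_apply, pairOp_comm f _ _ y x]

theorem hadamard_mul_edgeSum (s : ℝ) :
    (4 : ℂ) • (hadamard n * edgeSum G (phiVec s)) = edgeSum G (phiHat s) * hadamard n := by
  simp only [edgeSum, Finset.mul_sum, Finset.sum_mul, Finset.smul_sum]
  refine Finset.sum_congr rfl fun i _ => Finset.sum_congr rfl fun j _ => ?_
  split_ifs with h
  · exact hadamard_mul_pairOp s h.ne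
  · simp

theorem edgeSum_phiHat_update_ne_zero {s : ℝ} (hs0 : 0 ≤ s) (hs1 : s < 1) {i j : Fin n}
    (h : G.Adj i j) (k : Fin n → Bool) (b : Bool) :
    edgeSum G (phiHat s) k (Function.update k i b) ≠ 0 := by
  have hpos : ∀ b c, 0 < phiHat s b c := by
    intro b c
    simp only [phiHat]
    split_ifs
    · exact Complex.zero_lt_real.mpr (by linarith)
    · exact Complex.zero_lt_real.mpr (by linarith)
  have hnn : ∀ i' j', 0 ≤
      if G.Adj i' j' then pairOp (phiHat s) i' j' k (Function.update k i b) else 0 := by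
    intro i' j'
    split_ifs
    exacts [pairOp_nonneg (fun b c => (hpos b c).le) _ _ _ _, le_rfl]
  rw [edgeSum_apply]
  refine (Finset.sum_pos' (fun i' _ => Finset.sum_nonneg fun j' _ => hnn i' j')
    ⟨i, Finset.mem_univ i, Finset.sum_pos' (fun j' _ => hnn i j') ⟨j, Finset.mem_univ j, ?_⟩⟩).ne'
  rw [if_pos h]
  refine mul_pos (mul_pos (hpos _ _) (hpos _ _)) (Finset.prod_pos fun a ha => ?_)
  simp only [Finset.mem_erase, Finset.mem_univ, and_true] at ha
  simp [ha.2]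

theorem edgeSum_phiVec_eq_zero {s : ℝ} {x y : Fin n → Bool}
    (h : ∏ a, hadSign true (x a) ≠ ∏ a, hadSign true (y a)) :
    edgeSum G (phiVec s) x y = 0 := by
  rw [edgeSum_apply]
  refine Finset.sum_eq_zero fun i _ => Finset.sum_eq_zero fun j _ => ?_
  split_ifs with hij
  · by_contra hne
    exact h (hadSign_true_prod_eq hij.ne hne)
  · rfl

end edgeSum

/-- A set of bit strings closed under changing single bits is empty or everything. -/
theorem forall_of_forall_update {n : ℕ} {p : (Fin n → Bool) → Prop}
    (hp : ∀ k i b, p k → p (Function.update k i b)) {k : Fin n → Bool} (hk : p k)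
    (l : Fin n → Bool) : p l := by
  have h : ∀ t : Finset (Fin n), p (t.piecewise l k) := by
    intro t
    induction t using Finset.induction_on with
    | empty => simpa using hk
    | insert a t _ ih =>
      rw [Finset.piecewise_insert]
      exact hp _ _ _ ih
  simpa using h Finset.univ

/-- On a connected graph the ground state of H_s is non-degenerate, and can be
chosen supported on even-weight strings with nonnegative amplitudes. -/
theorem stmt16 {n : ℕ} (hn : 2 ≤ n)
    (G : SimpleGraph (Fin n)) [DecidableRel G.Adj] (hconn : G.Connected)
    (s : ℝ) (hs0 : 0 ≤ s) (hs1 : s < 1)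
    (H : Matrix (Fin n → Bool) (Fin n → Bool) ℂ)
    (hH : H = -(1/2 : ℂ) •
      ∑ i : Fin n, ∑ j : Fin n, if G.Adj i j then projPhi s i j else 0) :
    ∃ μ : ℝ,
      Module.End.HasEigenvalue (Matrix.toLin' H) (μ : ℂ) ∧
      (∀ ν : ℂ, Module.End.HasEigenvalue (Matrix.toLin' H) ν → μ ≤ ν.re) ∧
      Module.finrank ℂ (Module.End.eigenspace (Matrix.toLin' H) (μ : ℂ)) = 1 ∧
      ∃ ψ : (Fin n → Bool) → ℂ, ψ ≠ 0 ∧ H.mulVec ψ = (μ : ℂ) • ψ ∧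
        (∀ x : Fin n → Bool,
          Odd (Finset.univ.filter (fun a => x a)).card → ψ x = 0) ∧
        (∀ x : Fin n → Bool,
          Even (Finset.univ.filter (fun a => x a)).card →
            (ψ x).im = 0 ∧ 0 ≤ (ψ x).re) := by
  set A : Matrix (Fin n → Bool) (Fin n → Bool) ℂ := (1 / 2 : ℂ) • edgeSum G (phiVec s) with hA
  set B : Matrix (Fin n → Bool) (Fin n → Bool) ℂ := (1 / 8 : ℂ) • edgeSum G (phiHat s) with hB
  set U := hadamard n with hU
  have hHA : H = -A := by
    rw [hH, hA, neg_smul]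
    rfl
  have hvec : ∀ b c, 0 ≤ phiVec s b c := by
    intro b c
    simp only [phiVec]
    split_ifs
    exacts [zero_le_one, Complex.zero_le_real.mpr hs0, le_rfl]
  have hhat : ∀ b c, 0 ≤ phiHat s b c := by
    intro b c
    simp only [phiHat]
    split_ifs <;> exact Complex.zero_le_real.mpr (by linarith)
  have half : (0 : ℂ) ≤ 1 / 2 := by positivity
  have eighth : (0 : ℂ) ≤ 1 / 8 := by positivity
  have hA0 : ∀ x y, 0 ≤ A x y := fun x y => mul_nonneg half (edgeSum_nonneg G hvec x y)
  have hB0 : ∀ x y, 0 ≤ B x y := fun x y => mul_nonneg eighth (edgeSum_nonneg G hhat x y)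
  have hAh : A.IsHermitian :=
    IsSelfAdjoint.smul (IsSelfAdjoint.of_nonneg half) (edgeSum_isHermitian G hvec)
  have hBh : B.IsHermitian :=
    IsSelfAdjoint.smul (IsSelfAdjoint.of_nonneg eighth) (edgeSum_isHermitian G hhat)
  have hUU : U * U = (2 ^ n : ℂ) • 1 := hadamard_mul_self n
  have hUh : Uᴴ = U := hadamard_isHermitian n
  have hUA : U * A = B * U := by
    rw [hA, hB, Matrix.mul_smul, Matrix.smul_mul, ← hadamard_mul_edgeSum, smul_smul]
    norm_num [hU]
  have hAU : A * U = U * B := by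
    have h := congrArg Matrix.conjTranspose hUA
    rwa [Matrix.conjTranspose_mul, Matrix.conjTranspose_mul, hUh, hAh.eq, hBh.eq] at h
  have hpow : (2 ^ n : ℂ) ≠ 0 := pow_ne_zero _ two_ne_zero
  have hUinj : ∀ v, U *ᵥ v = 0 → v = 0 := by
    intro v hv
    have h : U *ᵥ (U *ᵥ v) = (2 ^ n : ℂ) • v := by
      rw [Matrix.mulVec_mulVec, hUU, Matrix.smul_mulVec, Matrix.one_mulVec]
    rw [hv, Matrix.mulVec_zero] at h
    exact (smul_eq_zero.mp h.symm).resolve_left hpow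
  obtain ⟨t, v, hv0, hv, htA⟩ := hAh.exists_top_eigenvector
  have htB : ((t : ℂ) • (1 : Matrix (Fin n → Bool) (Fin n → Bool) ℂ) - B).PosSemidef := by
    have h := (htA.mul_mul_conjTranspose_same U).smul (a := (2 ^ n : ℂ)⁻¹) (by positivity)
    have he : (t : ℂ) • (1 : Matrix (Fin n → Bool) (Fin n → Bool) ℂ) - B =
        (2 ^ n : ℂ)⁻¹ • (U * ((t : ℂ) • 1 - A) * Uᴴ) := by
      rw [hUh, Matrix.mul_sub, Matrix.sub_mul, hUA, Matrix.mul_assoc B, hUU, Matrix.mul_smul,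
        Matrix.smul_mul, Matrix.mul_one, hUU, Matrix.mul_smul, Matrix.mul_one, smul_sub,
        smul_smul, smul_smul, smul_smul, inv_mul_cancel₀ hpow, one_smul, mul_right_comm,
        inv_mul_cancel₀ hpow, one_mul]
    rwa [he]
  have hUv : ∀ v, A *ᵥ v = (t : ℂ) • v → B *ᵥ (U *ᵥ v) = (t : ℂ) • (U *ᵥ v) := by
    intro v hv
    rw [Matrix.mulVec_mulVec, ← hUA, ← Matrix.mulVec_mulVec, hv, Matrix.mulVec_smul]
  have hinj : ∀ v, A *ᵥ v = (t : ℂ) • v → (U *ᵥ v) (fun _ => false) = 0 → v = 0 := by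
    intro v hv hz
    have hw := Matrix.mulVec_norm_of_mulVec_eq hB0 htB (hUv v hv)
    have hall := forall_of_forall_update
      (p := fun k => ((‖(U *ᵥ v) k‖ : ℝ) : ℂ) = 0) (fun k i b hk => by
        have : Nontrivial (Fin n) := Fin.nontrivial_iff_two_le.mpr hn
        obtain ⟨j, hij⟩ := hconn.preconnected.exists_adj_of_nontrivial i
        exact Matrix.eq_zero_of_mulVec_eq hB0
          (fun x => Complex.zero_le_real.mpr (norm_nonneg _)) hw hk
          (mul_ne_zero (by norm_num) (edgeSum_phiHat_update_ne_zero G hs0 hs1 hij k b)))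
      (k := fun _ => false) (by simp [hz])
    refine hUinj v (funext fun k => ?_)
    simpa using hall k
  have heig : ∀ v, H *ᵥ v = ((-t : ℝ) : ℂ) • v ↔ A *ᵥ v = (t : ℂ) • v := by
    intro v
    rw [hHA, Matrix.neg_mulVec, Complex.ofReal_neg, neg_smul, neg_inj]
  have hHv : Module.End.HasEigenvector (Matrix.toLin' H) ((-t : ℝ) : ℂ) v :=
    ⟨Module.End.mem_eigenspace_iff.mpr (by rw [Matrix.toLin'_apply, heig, hv]), hv0⟩
  refine ⟨-t, Module.End.hasEigenvalue_of_hasEigenvector hHv, ?_, ?_, ?_⟩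
  · intro ν hν
    rw [hHA] at hν
    exact Matrix.le_re_of_hasEigenvalue_neg htA hν
  · set E := Module.End.eigenspace (Matrix.toLin' H) ((-t : ℝ) : ℂ) with hE
    have hmem : ∀ w ∈ E, A *ᵥ w = (t : ℂ) • w := by
      intro w hw
      rw [← heig, ← Matrix.toLin'_apply]
      exact Module.End.mem_eigenspace_iff.mp hw
    refine le_antisymm ?_ ?_
    · let F : E →ₗ[ℂ] ℂ :=
        (LinearMap.proj (fun _ => false) ∘ₗ Matrix.toLin' U) ∘ₗ E.subtype
      have hF : Function.Injective F := by
        rw [injective_iff_map_eq_zero]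
        rintro ⟨w, hw⟩ h
        exact Subtype.ext (hinj w (hmem w hw) h)
      simpa using LinearMap.finrank_le_finrank_of_injective hF
    · have : Nontrivial E := ⟨⟨v, hHv.1⟩, 0, fun h => hv0 (congrArg Subtype.val h)⟩
      exact Module.finrank_pos
  · set w : (Fin n → Bool) → ℂ := fun k => (‖(U *ᵥ v) k‖ : ℂ) with hw
    have hBw : B *ᵥ w = (t : ℂ) • w := Matrix.mulVec_norm_of_mulVec_eq hB0 htB (hUv v hv)
    have hAu : A *ᵥ (U *ᵥ w) = (t : ℂ) • (U *ᵥ w) := by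
      rw [Matrix.mulVec_mulVec, hAU, ← Matrix.mulVec_mulVec, hBw, Matrix.mulVec_smul]
    have hu0 : (U *ᵥ w) (fun _ => false) ≠ 0 := by
      have h : (U *ᵥ w) (fun _ => false) = ((∑ k, ‖(U *ᵥ v) k‖ : ℝ) : ℂ) := by
        simp [Matrix.mulVec, dotProduct, hU, hadamard, hadSign, hw]
      rw [h, Complex.ofReal_ne_zero]
      intro hz
      rw [Finset.sum_eq_zero_iff_of_nonneg fun _ _ => norm_nonneg _] at hz
      exact hv0 (hUinj v (funext fun k => norm_eq_zero.mp (hz k (Finset.mem_univ k))))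
    have habs := Matrix.mulVec_norm_of_mulVec_eq hA0 htA hAu
    let par : (Fin n → Bool) → ℂ := fun x => ∏ a, hadSign true (x a)
    have hpar : ∀ x, par x = (-1) ^ (Finset.univ.filter (fun a => x a)).card := hadSign_true_prod
    refine ⟨fun x => if par x = 1 then (‖(U *ᵥ w) x‖ : ℂ) else 0, ?_, ?_, ?_, ?_⟩
    · intro h
      have h0 := congrFun h (fun _ => false)
      have h1 : par (fun _ => false) = 1 := by simp [par, hadSign]
      simp only [h1, if_true, Pi.zero_apply, Complex.ofReal_eq_zero, norm_eq_zero] at h0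
      exact hu0 h0
    · rw [heig]
      funext x
      have hx := congrFun habs x
      simp only [Matrix.mulVec, dotProduct, Pi.smul_apply, smul_eq_mul] at hx ⊢
      have hzero : ∀ y, par x ≠ par y → A x y = 0 := fun y hxy => by
        rw [hA, Matrix.smul_apply, edgeSum_phiVec_eq_zero G hxy, smul_zero]
      by_cases hp : par x = 1
      · rw [if_pos hp, ← hx]
        refine Finset.sum_congr rfl fun y _ => ?_
        split_ifs with hy
        · rfl
        · rw [hzero y (by rw [hp]; exact Ne.symm hy), zero_mul, zero_mul]
      · rw [if_neg hp, mul_zero]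
        refine Finset.sum_eq_zero fun y _ => ?_
        split_ifs with hy
        · rw [hzero y (by rw [hy]; exact hp), zero_mul]
        · rw [mul_zero]
    · intro x hx
      have : par x ≠ 1 := by rw [hpar, hx.neg_one_pow]; norm_num
      exact if_neg this
    · intro x hx
      have : par x = 1 := by rw [hpar, hx.neg_one_pow]
      simp [this]
end

section
/- Let n ≥ 3, let G be the star graph on vertices {1,…,n} with edges {(1,i) : 2 ≤ i ≤ n}, let 0 ≤ s < 1, and let H_s = −∑_{i=2}^n |φ_s⟩⟨φ_s|_{1,i} where |φ_s⟩ = |00⟩ + s|11⟩. Let λ_1 ≤ λ_2 be the two smallest eigenvalues of H_s (counted with multiplicity). Then λ_1 = −(n−1+s²) and λ_2 − λ_1 = 1 − s². -/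
open Complex Finset

/-- The configuration `x` with the bits at `z` and `i` flipped. -/
def flipPair {n : ℕ} (z i : Fin n) (x : Fin n → Bool) : Fin n → Bool :=
  fun a => if a = z ∨ a = i then !x a else x a

/-- The number of ones on the leaves minus the bit at the centre `z`. It is conserved by
every star-graph term. -/
def starCharge {n : ℕ} (z : Fin n) (x : Fin n → Bool) : ℤ :=
  (∑ i ∈ Finset.univ.erase z, if x i then 1 else 0) - if x z then 1 else 0

/-- A nonnegative weight, an eigenvector of the star sum on each charge sector. -/
def starWeight {n : ℕ} (s : ℝ) (z : Fin n) (x : Fin n → Bool) : ℝ :=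
  if x z then s * (starCharge z x + 1) else (n : ℝ) - 1 - starCharge z x

/-- The eigenvalue of the star sum for `starWeight` on the sector of charge `q`. -/
def sectorValue (n : ℕ) (s : ℝ) (q : ℤ) : ℝ := (n : ℝ) - 1 - q + s ^ 2 * (q + 1)

/-- The sum of the two-qubit terms over the edges of the star with centre `z`. -/
noncomputable def starSum {n : ℕ} (s : ℝ) (z : Fin n) :
    Matrix (Fin n → Bool) (Fin n → Bool) ℂ :=
  ∑ i ∈ Finset.univ.erase z, projPhi s z i

section

variable {n : ℕ} {s : ℝ} {z : Fin n}

lemma flipPair_flipPair (z i : Fin n) (x : Fin n → Bool) :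
    flipPair z i (flipPair z i x) = x := by
  funext a
  by_cases h : a = z ∨ a = i <;> simp [flipPair, h]

lemma flipPair_center (z i : Fin n) (x : Fin n → Bool) : flipPair z i x z = !x z := by
  simp [flipPair]

lemma flipPair_leaf (z i : Fin n) (x : Fin n → Bool) : flipPair z i x i = !x i := by
  simp [flipPair]

lemma projPhi_mulVec (i : Fin n) (f : (Fin n → Bool) → ℂ) (x : Fin n → Bool) :
    (projPhi s z i).mulVec f x =
      if x i = x z then
        (if x z then (s : ℂ) * (s * f x + f (flipPair z i x))
          else f x + s * f (flipPair z i x))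
      else 0 := by
  have hne : x ≠ flipPair z i x := by
    intro h
    have := congrFun h z
    simp [flipPair_center] at this
  simp only [Matrix.mulVec, dotProduct, projPhi, Matrix.of_apply, Finset.prod_boole]
  rw [Finset.sum_eq_add x (flipPair z i x) hne]
  · have h1 : ∀ a ∈ (Finset.univ.erase z).erase i, x a = flipPair z i x a := by
      intro a ha
      simp only [Finset.mem_erase, Finset.mem_univ, and_true] at ha
      simp [flipPair, ha.1, ha.2]
    rw [if_pos h1, if_pos (fun _ _ => rfl), flipPair_center, flipPair_leaf]
    cases x z <;> cases x i <;> (simp; try ring)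
  · rintro y - ⟨hy1, hy2⟩
    by_cases hp : ∀ a ∈ (Finset.univ.erase z).erase i, x a = y a
    · have hpa : ∀ a, a ≠ z → a ≠ i → x a = y a := fun a h1 h2 => hp a (by simp [h1, h2])
      have hbits : ¬ (x z = x i ∧ y z = y i) := by
        rintro ⟨hx, hy⟩
        by_cases hz : y z = x z
        · apply hy1
          funext a
          by_cases haz : a = z
          · rw [haz, hz]
          by_cases hai : a = i
          · rw [hai, ← hy, hz, hx]
          exact (hpa a haz hai).symm
        · apply hy2
          have hz' : y z = !x z := Bool.eq_not_of_ne hz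
          funext a
          by_cases haz : a = z
          · rw [haz, hz', flipPair_center]
          by_cases hai : a = i
          · rw [hai, ← hy, hz', hx, flipPair_leaf]
          simp [flipPair, haz, hai, hpa a haz hai]
      revert hbits
      cases x z <;> cases x i <;> cases y z <;> cases y i <;> simp
    · rw [if_neg hp]; ring
  · simp
  · simp

lemma starSum_mulVec (f : (Fin n → Bool) → ℂ) (x : Fin n → Bool) :
    (starSum s z).mulVec f x = ∑ i ∈ (Finset.univ.erase z).filter (fun i => x i = x z),
        (if x z then (s : ℂ) * (s * f x + f (flipPair z i x))
          else f x + s * f (flipPair z i x)) := by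
  rw [starSum, Matrix.sum_mulVec, Finset.sum_apply, Finset.sum_filter]
  refine Finset.sum_congr rfl fun i _ => projPhi_mulVec i f x

lemma starCharge_flipPair {i : Fin n} (hi : i ≠ z) {x : Fin n → Bool} (h : x i = x z) :
    starCharge z (flipPair z i x) = starCharge z x := by
  have hm : i ∈ Finset.univ.erase z := by simp [hi]
  unfold starCharge
  rw [← Finset.add_sum_erase _ _ hm, ← Finset.add_sum_erase _ _ hm, flipPair_leaf,
    flipPair_center]
  have : ∑ a ∈ (Finset.univ.erase z).erase i, (if flipPair z i x a then (1 : ℤ) else 0) =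
      ∑ a ∈ (Finset.univ.erase z).erase i, if x a then 1 else 0 := by
    refine Finset.sum_congr rfl fun a ha => ?_
    simp only [Finset.mem_erase, Finset.mem_univ, and_true] at ha
    simp [flipPair, ha.1, ha.2]
  rw [this, h]
  cases x z <;> simp

lemma card_leaves_eq_center (z : Fin n) (x : Fin n → Bool) :
    (((Finset.univ.erase z).filter (fun i => x i = x z)).card : ℤ) =
      if x z then starCharge z x + 1 else (n : ℤ) - 1 - starCharge z x := by
  have hn : ((Finset.univ.erase z).card : ℤ) = n - 1 := by
    rw [Finset.card_erase_of_mem (Finset.mem_univ z), Finset.card_univ, Fintype.card_fin,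
      Nat.cast_sub (by have := z.isLt; omega), Nat.cast_one]
  rw [Finset.card_filter, starCharge]
  push_cast
  cases hx : x z
  · rw [← hn, Finset.card_eq_sum_ones]
    push_cast
    rw [sub_zero, ← Finset.sum_sub_distrib]
    refine Finset.sum_congr rfl fun i _ => ?_
    cases x i <;> simp
  · simp

lemma card_leaves_eq_center_real (z : Fin n) (x : Fin n → Bool) :
    (((Finset.univ.erase z).filter (fun i => x i = x z)).card : ℝ) =
      if x z then (starCharge z x : ℝ) + 1 else (n : ℝ) - 1 - starCharge z x := by
  have := congrArg (Int.cast : ℤ → ℝ) (card_leaves_eq_center z x)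
  rw [Int.cast_natCast] at this
  rw [this]
  split_ifs <;> push_cast <;> rfl

lemma starWeight_eq_card (s : ℝ) (z : Fin n) (x : Fin n → Bool) :
    starWeight s z x = (if x z then s else 1) *
      ((Finset.univ.erase z).filter (fun i => x i = x z)).card := by
  rw [card_leaves_eq_center_real, starWeight]
  split_ifs <;> ring

lemma starWeight_flipPair {i : Fin n} (hi : i ≠ z) {x : Fin n → Bool} (h : x i = x z) :
    starWeight s z (flipPair z i x) =
      if x z then (n : ℝ) - 1 - starCharge z x else s * (starCharge z x + 1) := by
  rw [starWeight, starCharge_flipPair hi h, flipPair_center]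
  cases x z <;> simp

lemma starSum_mulVec_starWeight (g : ℤ → ℂ) :
    (starSum s z).mulVec (fun x => g (starCharge z x) * starWeight s z x) =
      fun x => sectorValue n s (starCharge z x) * (g (starCharge z x) * starWeight s z x) := by
  funext x
  have hc := congrArg (Complex.ofReal) (card_leaves_eq_center_real z x)
  rw [starSum_mulVec]
  have : ∀ i ∈ (Finset.univ.erase z).filter (fun i => x i = x z),
      (if x z then (s : ℂ) * (s * (g (starCharge z x) * starWeight s z x) +
          g (starCharge z (flipPair z i x)) * starWeight s z (flipPair z i x))
        else g (starCharge z x) * starWeight s z x + s *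
          (g (starCharge z (flipPair z i x)) * starWeight s z (flipPair z i x))) =
      (if x z then (s : ℂ) else 1) *
        (g (starCharge z x) * sectorValue n s (starCharge z x)) := by
    intro i hi
    simp only [Finset.mem_filter, Finset.mem_erase, Finset.mem_univ, and_true] at hi
    rw [starCharge_flipPair hi.1 hi.2, starWeight_flipPair hi.1 hi.2, starWeight, sectorValue]
    split_ifs <;> push_cast <;> ring
  rw [Finset.sum_congr rfl this, Finset.sum_const, nsmul_eq_mul, starWeight_eq_card]
  push_cast
  split_ifs <;> push_cast <;> ring

lemma starWeight_nonneg (hs : 0 ≤ s) (x : Fin n → Bool) : 0 ≤ starWeight s z x := by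
  rw [starWeight_eq_card]
  split_ifs <;> positivity

lemma starSum_mulVec_eq_zero (f : (Fin n → Bool) → ℂ) {x : Fin n → Bool}
    (hx : starWeight s z x = 0) : (starSum s z).mulVec f x = 0 := by
  rw [starWeight_eq_card, mul_eq_zero] at hx
  rw [starSum_mulVec]
  rcases hx with hx | hx
  · split_ifs at hx with h
    · simp [h, hx]
    · simp at hx
  · rw [Nat.cast_eq_zero, Finset.card_eq_zero] at hx
    rw [hx, Finset.sum_empty]

lemma norm_starSum_mulVec_le (hs : 0 ≤ s) {f : (Fin n → Bool) → ℂ} {c : ℝ}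
    (hf : ∀ y, ‖f y‖ ≤ c * starWeight s z y) (x : Fin n → Bool) :
    ‖(starSum s z).mulVec f x‖ ≤ c * (sectorValue n s (starCharge z x) * starWeight s z x) := by
  rw [starSum_mulVec]
  have : ∀ i ∈ (Finset.univ.erase z).filter (fun i => x i = x z),
      ‖if x z then (s : ℂ) * (s * f x + f (flipPair z i x))
          else f x + s * f (flipPair z i x)‖ ≤
      (if x z then s else 1) * (c * sectorValue n s (starCharge z x)) := by
    intro i hi
    simp only [Finset.mem_filter, Finset.mem_erase, Finset.mem_univ, and_true] at hi
    have h1 := hf x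
    have h2 := hf (flipPair z i x)
    rw [starWeight_flipPair hi.1 hi.2] at h2
    rw [starWeight] at h1
    have hsn : ‖(s : ℂ)‖ = s := by rw [Complex.norm_real, Real.norm_of_nonneg hs]
    rw [sectorValue]
    split_ifs at h1 h2 ⊢
    · rw [norm_mul, hsn]
      refine mul_le_mul_of_nonneg_left ((norm_add_le _ _).trans ?_) hs
      rw [norm_mul, hsn]
      nlinarith [mul_le_mul_of_nonneg_left h1 hs]
    · refine (norm_add_le _ _).trans ?_
      rw [norm_mul, hsn]
      nlinarith [mul_le_mul_of_nonneg_left h2 hs]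
  refine (norm_sum_le_of_le _ this).trans (le_of_eq ?_)
  rw [Finset.sum_const, nsmul_eq_mul, starWeight_eq_card]
  ring

/-- A weighted Gershgorin bound away from the sector of charge zero. -/
lemma norm_le_sectorValue_one (hn : 2 ≤ n) (hs0 : 0 ≤ s) (hs1 : s < 1) {ν : ℂ}
    {f : (Fin n → Bool) → ℂ}
    (hf : (starSum s z).mulVec f = ν • f) (hf0 : f ≠ 0)
    (hq : ∀ x, starCharge z x = 0 → f x = 0) : ‖ν‖ ≤ sectorValue n s 1 := by
  have hn' : (2 : ℝ) ≤ n := by exact_mod_cast hn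
  by_cases hν : ν = 0
  · rw [hν, norm_zero, sectorValue]
    push_cast
    nlinarith [sq_nonneg s]
  have hsupp : ∀ x, starWeight s z x = 0 → f x = 0 := by
    intro x hx
    have h := congrFun hf x
    rw [starSum_mulVec_eq_zero f hx, Pi.smul_apply, smul_eq_mul] at h
    exact (mul_eq_zero.mp h.symm).resolve_left hν
  obtain ⟨a, ha⟩ := Finite.exists_max fun x => ‖f x‖ / starWeight s z x
  have hpos : ∀ x, f x ≠ 0 → 0 < starWeight s z x := fun x hx =>
    lt_of_le_of_ne (starWeight_nonneg hs0 x) fun h => hx (hsupp x h.symm)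
  obtain ⟨b, hb⟩ := Function.ne_iff.mp hf0
  have hc : 0 < ‖f a‖ / starWeight s z a :=
    lt_of_lt_of_le (div_pos (norm_pos_iff.mpr hb) (hpos b hb)) (ha b)
  have hfa : f a ≠ 0 := by
    intro h
    simp [h] at hc
  have hwa := hpos a hfa
  have hbound := norm_starSum_mulVec_le hs0 (c := ‖f a‖ / starWeight s z a) (f := f)
    (z := z) (fun y => by
      by_cases hy : f y = 0
      · rw [hy, norm_zero]
        exact mul_nonneg hc.le (starWeight_nonneg hs0 y)
      · exact (div_le_iff₀ (hpos y hy)).mp (ha y)) a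
  rw [hf, Pi.smul_apply, smul_eq_mul, norm_mul] at hbound
  have heq : ‖f a‖ / starWeight s z a *
      (sectorValue n s (starCharge z a) * starWeight s z a) =
      sectorValue n s (starCharge z a) * ‖f a‖ := by
    field_simp
  rw [heq] at hbound
  refine (le_of_mul_le_mul_right hbound (norm_pos_iff.mpr hfa)).trans ?_
  have hq0 : starCharge z a ≠ 0 := fun h => hfa (hq a h)
  have hq1 : 0 ≤ starCharge z a := by
    by_cases hz : a z
    · rw [starWeight, if_pos hz] at hwa
      have : (0 : ℝ) < starCharge z a + 1 := pos_of_mul_pos_right hwa hs0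
      have : (0 : ℤ) < starCharge z a + 1 := by exact_mod_cast this
      omega
    · rw [starCharge, if_neg hz, sub_zero]
      exact Finset.sum_nonneg fun i _ => by split_ifs <;> simp
  have hq2 : (1 : ℝ) ≤ starCharge z a := by
    have : (1 : ℤ) ≤ starCharge z a := by omega
    exact_mod_cast this
  rw [sectorValue, sectorValue]
  push_cast
  nlinarith [mul_nonneg (sub_nonneg.mpr hq2) (show (0 : ℝ) ≤ 1 - s ^ 2 by nlinarith)]

lemma starCharge_const_false : starCharge z (fun _ => false) = 0 := by
  simp [starCharge]

lemma eq_of_starCharge_eq_zero {x : Fin n → Bool} (hx : starCharge z x = 0) :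
    x = (fun _ => false) ∨ ∃ i, i ≠ z ∧ x = flipPair z i (fun _ => false) := by
  rw [starCharge, Finset.sum_boole] at hx
  by_cases hz : x z
  · right
    rw [if_pos hz, sub_eq_zero] at hx
    have hx' : ((Finset.univ.erase z).filter (fun i => x i = true)).card = 1 := by
      exact_mod_cast hx
    obtain ⟨i, hi⟩ := Finset.card_eq_one.mp hx'
    have hmem : ∀ a, (a ≠ z ∧ x a = true) ↔ a = i := fun a => by
      rw [← Finset.mem_singleton (a := i), ← hi]
      simp
    have hii := (hmem i).mpr rfl
    refine ⟨i, hii.1, ?_⟩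
    funext a
    by_cases haz : a = z
    · simp [haz, hz, flipPair]
    by_cases hai : a = i
    · simp [hai, hii.2, flipPair]
    have := mt (hmem a).mp hai
    simp only [flipPair, haz, hai, or_self, if_false]
    simpa [haz] using this
  · left
    rw [if_neg hz, sub_zero] at hx
    have hx' : ((Finset.univ.erase z).filter (fun i => x i = true)).card = 0 := by
      exact_mod_cast hx
    rw [Finset.card_eq_zero] at hx'
    funext a
    by_cases haz : a = z
    · simpa [haz] using hz
    · by_contra ha
      have : a ∈ (Finset.univ.erase z).filter (fun i => x i = true) := by
        simpa [haz] using ha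
      rw [hx'] at this
      simp at this

lemma starSum_mulVec_const_false (f : (Fin n → Bool) → ℂ) :
    (starSum s z).mulVec f (fun _ => false) =
      ∑ i ∈ Finset.univ.erase z, (f (fun _ => false) + s * f (flipPair z i fun _ => false)) := by
  rw [starSum_mulVec]
  simp

lemma starSum_mulVec_flipPair_const_false {i : Fin n} (hi : i ≠ z)
    (f : (Fin n → Bool) → ℂ) :
    (starSum s z).mulVec f (flipPair z i fun _ => false) =
      s * (s * f (flipPair z i fun _ => false) + f (fun _ => false)) := by
  have : (Finset.univ.erase z).filter
      (fun a => flipPair z i (fun _ => false) a = flipPair z i (fun _ => false) z) = {i} := by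
    ext a
    by_cases haz : a = z
    · simp [haz, hi.symm]
    · simp [haz, flipPair]
  rw [starSum_mulVec, this, Finset.sum_singleton, flipPair_flipPair, flipPair_center]
  simp

lemma eq_zero_of_starCharge_eq_zero {ν : ℂ} {f : (Fin n → Bool) → ℂ}
    (hf : (starSum s z).mulVec f = ν • f) (hν : ν ≠ (s : ℂ) ^ 2)
    (h0 : f (fun _ => false) = 0) (x : Fin n → Bool) (hx : starCharge z x = 0) : f x = 0 := by
  rcases eq_of_starCharge_eq_zero hx with rfl | ⟨i, hi, rfl⟩
  · exact h0
  · have h := congrFun hf (flipPair z i fun _ => false)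
    rw [starSum_mulVec_flipPair_const_false hi, h0, Pi.smul_apply, smul_eq_mul] at h
    have h' : (ν - (s : ℂ) ^ 2) * f (flipPair z i fun _ => false) = 0 := by
      linear_combination -h
    exact (mul_eq_zero.mp h').resolve_left (sub_ne_zero.mpr hν)

lemma apply_const_false_eq_zero {ν : ℂ} {f : (Fin n → Bool) → ℂ}
    (hf : (starSum s z).mulVec f = ν • f) (hν0 : ν ≠ 0)
    (hν1 : ν ≠ sectorValue n s 0) : f (fun _ => false) = 0 := by
  have h := congrFun hf (fun _ => false)
  rw [starSum_mulVec_const_false, Pi.smul_apply, smul_eq_mul] at h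
  have hleaf : ∀ i ∈ Finset.univ.erase z,
      (ν - (s : ℂ) ^ 2) * (f (fun _ => false) + s * f (flipPair z i fun _ => false)) =
        ν * f (fun _ => false) := by
    intro i hi
    have h := congrFun hf (flipPair z i fun _ => false)
    rw [starSum_mulVec_flipPair_const_false (Finset.ne_of_mem_erase hi), Pi.smul_apply,
      smul_eq_mul] at h
    linear_combination -(s : ℂ) * h
  have hsum := Finset.sum_congr rfl hleaf
  rw [← Finset.mul_sum, h, Finset.sum_const, nsmul_eq_mul,
    Finset.card_erase_of_mem (Finset.mem_univ z), Finset.card_univ, Fintype.card_fin,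
    Nat.cast_sub (by have := z.isLt; omega), Nat.cast_one] at hsum
  have hprod : ν * (ν - sectorValue n s 0) * f (fun _ => false) = 0 := by
    rw [sectorValue]
    push_cast
    linear_combination hsum
  exact (mul_eq_zero.mp hprod).resolve_left (mul_ne_zero hν0 (sub_ne_zero.mpr hν1))

lemma eq_sectorValue_zero_or_norm_le (hn : 2 ≤ n) (hs0 : 0 ≤ s) (hs1 : s < 1) {ν : ℂ}
    {f : (Fin n → Bool) → ℂ}
    (hf : (starSum s z).mulVec f = ν • f) (hf0 : f ≠ 0) :
    ν = sectorValue n s 0 ∨ ‖ν‖ ≤ sectorValue n s 1 := by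
  have hn' : (2 : ℝ) ≤ n := by exact_mod_cast hn
  have hM : s ^ 2 ≤ sectorValue n s 1 := by
    rw [sectorValue]
    push_cast
    nlinarith [sq_nonneg s]
  by_cases h1 : ν = sectorValue n s 0
  · exact Or.inl h1
  right
  by_cases h2 : ν = 0
  · rw [h2, norm_zero]
    exact (sq_nonneg s).trans hM
  by_cases h3 : ν = (s : ℂ) ^ 2
  · rw [h3, norm_pow, Complex.norm_real, Real.norm_of_nonneg hs0]
    exact hM
  exact norm_le_sectorValue_one hn hs0 hs1 hf hf0
    (eq_zero_of_starCharge_eq_zero hf h3 (apply_const_false_eq_zero hf h2 h1))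

/-- The restriction of `starWeight` to the sector of charge `q`. -/
noncomputable def sectorVector (s : ℝ) (z : Fin n) (q : ℤ) : (Fin n → Bool) → ℂ :=
  fun x => (if starCharge z x = q then 1 else 0) * starWeight s z x

lemma starSum_mulVec_sectorVector (s : ℝ) (z : Fin n) (q : ℤ) :
    (starSum s z).mulVec (sectorVector s z q) =
      (sectorValue n s q : ℂ) • sectorVector s z q := by
  unfold sectorVector
  rw [starSum_mulVec_starWeight (fun p => if p = q then 1 else 0)]
  funext x
  by_cases h : starCharge z x = q <;> simp [h]

lemma sectorVector_zero_const_false :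
    sectorVector s z 0 (fun _ => false) = (n : ℂ) - 1 := by
  simp [sectorVector, starCharge_const_false, starWeight]

lemma sectorVector_one_ne_zero (hn : 3 ≤ n) : sectorVector s z 1 ≠ 0 := by
  have : Nontrivial (Fin n) := Fin.nontrivial_iff_two_le.mpr (by omega)
  obtain ⟨i, hi⟩ := exists_ne z
  have hq : starCharge z (fun a => decide (a = i)) = 1 := by
    simp [starCharge, hi, hi.symm]
  intro h
  have h' := congrFun h (fun a => decide (a = i))
  simp only [sectorVector, hq, starWeight, hi.symm, Pi.zero_apply, if_true, one_mul,
    decide_false, Bool.false_eq_true, if_false] at h'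
  have h2 : (n : ℝ) - 1 - (1 : ℤ) = 0 := by exact_mod_cast h'
  have hn' : (3 : ℝ) ≤ n := by exact_mod_cast hn
  push_cast at h2
  linarith

lemma eq_smul_sectorVector_zero (hn : 2 ≤ n) (hs0 : 0 ≤ s) (hs1 : s < 1)
    {f : (Fin n → Bool) → ℂ}
    (hf : (starSum s z).mulVec f = (sectorValue n s 0 : ℂ) • f) :
    (f (fun _ => false) / ((n : ℂ) - 1)) • sectorVector s z 0 = f := by
  have hn' : (2 : ℝ) ≤ n := by exact_mod_cast hn
  have hn1 : (n : ℂ) - 1 ≠ 0 := by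
    have : (n : ℝ) - 1 ≠ 0 := by linarith
    exact_mod_cast this
  set c := f (fun _ => false) / ((n : ℂ) - 1) with hc
  by_contra hne
  have hg : (starSum s z).mulVec (f - c • sectorVector s z 0) =
      (sectorValue n s 0 : ℂ) • (f - c • sectorVector s z 0) := by
    rw [Matrix.mulVec_sub, Matrix.mulVec_smul, hf, starSum_mulVec_sectorVector, smul_sub,
      smul_comm]
  have hν : (sectorValue n s 0 : ℂ) ≠ (s : ℂ) ^ 2 := by
    have : sectorValue n s 0 ≠ s ^ 2 := by
      rw [sectorValue]
      push_cast
      intro h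
      linarith
    exact_mod_cast this
  have h0 : (f - c • sectorVector s z 0) (fun _ => false) = 0 := by
    rw [Pi.sub_apply, Pi.smul_apply, sectorVector_zero_const_false, smul_eq_mul, hc,
      div_mul_cancel₀ _ hn1, sub_self]
  have hle := norm_le_sectorValue_one hn hs0 hs1 hg (sub_ne_zero.mpr (Ne.symm hne))
    (eq_zero_of_starCharge_eq_zero hg hν h0)
  rw [Complex.norm_real] at hle
  have := (le_abs_self _).trans hle
  rw [sectorValue, sectorValue] at this
  push_cast at this
  nlinarith

end

/-- Spectral gap of the EPR-like Hamiltonian on a star graph: the smallest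
eigenvalue is λ₁ = −(n−1+s²), it is non-degenerate, λ₂ = λ₁ + (1−s²) is an
eigenvalue, and every other eigenvalue is at least λ₂. -/
theorem stmt17 {n : ℕ} (hn : 3 ≤ n) (s : ℝ) (hs0 : 0 ≤ s) (hs1 : s < 1)
    (H : Matrix (Fin n → Bool) (Fin n → Bool) ℂ)
    (hH : H = -∑ i ∈ Finset.univ.erase (⟨0, by omega⟩ : Fin n),
      projPhi s (⟨0, by omega⟩ : Fin n) i) :
    Module.End.HasEigenvalue (Matrix.toLin' H)
      ((-((n : ℝ) - 1 + s ^ 2) : ℝ) : ℂ) ∧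
    Module.finrank ℂ (Module.End.eigenspace (Matrix.toLin' H)
      ((-((n : ℝ) - 1 + s ^ 2) : ℝ) : ℂ)) = 1 ∧
    Module.End.HasEigenvalue (Matrix.toLin' H)
      ((-((n : ℝ) - 1 + s ^ 2) + (1 - s ^ 2) : ℝ) : ℂ) ∧
    (∀ ν : ℂ, Module.End.HasEigenvalue (Matrix.toLin' H) ν →
      ν = ((-((n : ℝ) - 1 + s ^ 2) : ℝ) : ℂ) ∨
      (-((n : ℝ) - 1 + s ^ 2) + (1 - s ^ 2) : ℝ) ≤ ν.re) := by
  set z : Fin n := ⟨0, by omega⟩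
  have hH' : H = -starSum s z := hH
  have happ : ∀ f, Matrix.toLin' H f = -(starSum s z).mulVec f := fun f => by
    rw [Matrix.toLin'_apply, hH', Matrix.neg_mulVec]
  have hmem : ∀ (ν : ℂ) f, f ∈ Module.End.eigenspace (Matrix.toLin' H) ν ↔
      (starSum s z).mulVec f = (-ν) • f := fun ν f => by
    rw [Module.End.mem_eigenspace_iff, happ, neg_eq_iff_eq_neg, neg_smul]
  have hE0 : ((-((n : ℝ) - 1 + s ^ 2) : ℝ) : ℂ) = -(sectorValue n s 0 : ℂ) := by
    rw [sectorValue]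
    push_cast
    ring
  have hE1 : ((-((n : ℝ) - 1 + s ^ 2) + (1 - s ^ 2) : ℝ) : ℂ) =
      -(sectorValue n s 1 : ℂ) := by
    rw [sectorValue]
    push_cast
    ring
  have hv : ∀ q, sectorVector s z q ∈
      Module.End.eigenspace (Matrix.toLin' H) (-(sectorValue n s q : ℂ)) := fun q => by
    rw [hmem, neg_neg, starSum_mulVec_sectorVector]
  have hn' : (3 : ℝ) ≤ n := by exact_mod_cast hn
  have hv0 : sectorVector s z 0 ≠ 0 := by
    intro h
    have h' := congrFun h (fun _ => false)
    rw [sectorVector_zero_const_false, Pi.zero_apply] at h'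
    have : (n : ℝ) - 1 = 0 := by exact_mod_cast h'
    linarith
  refine ⟨?_, ?_, ?_, ?_⟩
  · rw [hE0]
    exact Module.End.hasEigenvalue_of_hasEigenvector ⟨hv 0, hv0⟩
  · rw [hE0]
    refine finrank_eq_one (⟨sectorVector s z 0, hv 0⟩ : Module.End.eigenspace _ _)
      (fun h => hv0 (congrArg Subtype.val h)) ?_
    rintro ⟨f, hf⟩
    rw [hmem, neg_neg] at hf
    exact ⟨_, Subtype.ext (eq_smul_sectorVector_zero (by omega) hs0 hs1 hf)⟩
  · rw [hE1]
    exact Module.End.hasEigenvalue_of_hasEigenvector ⟨hv 1, sectorVector_one_ne_zero hn⟩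
  · intro ν hν
    obtain ⟨f, hf, hf0⟩ := hν.exists_hasEigenvector
    rw [hmem] at hf
    rcases eq_sectorValue_zero_or_norm_le (by omega) hs0 hs1 hf hf0 with h | h
    · left
      rw [hE0, ← h, neg_neg]
    · right
      have hre := (Complex.re_le_norm (-ν)).trans h
      rw [Complex.neg_re, sectorValue] at hre
      push_cast at hre
      linarith
end
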